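/- arXiv:math/0305408 — 2 statements merged into one kernel-verified Lean document; each statement's English description precedes it below -/
import Mathlib

section
/- Let γ ≥ 0 and let F : [0,∞) → [0,∞) be continuous with F(0) = 0, F > 0 on (0,∞) and F strictly increasing on (0,∞). If ∫₀¹ dx/F(x) = +∞, then the only continuous function y : [0,∞) → [0,∞) satisfying y(t) = e^{−γt} F(∫₀ᵗ y(s) ds) for all t ≥ 0 is the constant function y ≡ 0. -/
open MeasureTheory Real Set Filter intervalIntegral

noncomputable section

/-- If the integrals of a nonnegative `g` over `(x, T]` are bounded uniformly in `x ∈ (0, T]`, then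
`g` is integrable on `(0, T]`. -/
lemma integrableOn_Ioc_zero_of_integral_le {g : ℝ → ℝ} {T C : ℝ} (hT : 0 < T)
    (hg : ContinuousOn g (Ioi 0)) (hpos : ∀ x, 0 < x → 0 ≤ g x)
    (hC : ∀ x, 0 < x → x ≤ T → ∫ u in x..T, g u ≤ C) :
    IntegrableOn g (Ioc 0 T) := by
  obtain ⟨a, -, ha, hlim⟩ := exists_seq_strictAnti_tendsto' hT
  refine integrableOn_Ioc_of_intervalIntegral_norm_bounded_left (I := C) (l := atTop)
    (fun n => ?_) hlim (Eventually.of_forall fun n => ?_)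
  · exact ((hg.mono fun x hx => (ha n).1.trans_le hx.1 :
      ContinuousOn g (Icc (a n) T)).integrableOn_Icc).mono_set Ioc_subset_Icc_self
  · rw [← integral_of_le (ha n).2.le]
    refine (integral_congr fun x hx => ?_).trans_le (hC _ (ha n).1 (ha n).2.le)
    rw [uIcc_of_le (ha n).2.le] at hx
    exact Real.norm_of_nonneg (hpos x ((ha n).1.trans_le hx.1))

/-- Osgood-type uniqueness for the nonlinear integral equation
`y(t) = e^{−γt} F(∫₀ᵗ y)`: if `∫₀¹ dx/F(x) = +∞`, the only nonnegative continuous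
solution is `y ≡ 0`. -/
theorem integral_equation_osgood_uniqueness
    (γ : ℝ) (hγ : 0 ≤ γ) (F : ℝ → ℝ)
    (hFc : ContinuousOn F (Ici 0)) (hF0 : F 0 = 0)
    (hFpos : ∀ x : ℝ, 0 < x → 0 < F x)
    (hFmono : StrictMonoOn F (Ioi 0))
    (hOsgood : ¬ IntegrableOn (fun x => (F x)⁻¹) (Ioc 0 1))
    (y : ℝ → ℝ) (hyc : ContinuousOn y (Ici 0))
    (hynonneg : ∀ t : ℝ, 0 ≤ t → 0 ≤ y t)
    (heq : ∀ t : ℝ, 0 ≤ t →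
      y t = Real.exp (-γ * t) * F (∫ s in (0:ℝ)..t, y s)) :
    ∀ t : ℝ, 0 ≤ t → y t = 0 := by
  intro t ht
  by_contra hyt
  set Y : ℝ → ℝ := fun t => ∫ s in (0:ℝ)..t, y s with hY
  set z : ℝ → ℝ := fun s => y (max s 0) with hz
  have hzy : ∀ s, 0 ≤ s → z s = y s := fun s hs => by simp [hz, hs]
  have hzc : Continuous z :=
    hyc.comp_continuous (continuous_id.max continuous_const) fun s => le_max_right s 0
  have hz0 : ∀ s, 0 ≤ z s := fun s => hynonneg _ (le_max_right s 0)
  set Z : ℝ → ℝ := fun t => ∫ s in (0:ℝ)..t, z s with hZ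
  have hZY : ∀ t, 0 ≤ t → Z t = Y t := fun t ht =>
    integral_congr fun s hs => hzy s (by rw [uIcc_of_le ht] at hs; exact hs.1)
  have hZd : ∀ t, HasDerivAt Z (z t) t := fun t =>
    (hzc.integral_hasStrictDerivAt 0 t).hasDerivAt
  have hZc : Continuous Z := continuous_iff_continuousAt.2 fun t => (hZd t).continuousAt
  have hZmono : Monotone Z := monotone_of_hasDerivAt_nonneg hZd hz0
  have hZ0 : Z 0 = 0 := integral_same
  have hZeq : ∀ s, 0 ≤ s → z s = Real.exp (-γ * s) * F (Z s) := fun s hs => by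
    rw [hzy s hs, hZY s hs, heq s hs]
  have hT : 0 < Z t := by
    refine lt_of_le_of_ne (hZ0 ▸ hZmono ht) fun h => hyt ?_
    rw [← hzy t ht, hZeq t ht, ← h, hF0, mul_zero]
  have hgc : ContinuousOn (fun x => (F x)⁻¹) (Ioi 0) :=
    (hFc.mono Ioi_subset_Ici_self).inv₀ fun x hx => (hFpos x hx).ne'
  have hbound : ∀ x, 0 < x → x ≤ Z t → ∫ u in x..Z t, (F u)⁻¹ ≤ t := by
    intro x hx hxT
    obtain ⟨r, ⟨hr0, hrt⟩, rfl⟩ :=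
      intermediate_value_Icc ht hZc.continuousOn (show x ∈ Icc (Z 0) (Z t) from ⟨by simp [hZ0, hx.le], hxT⟩)
    have hpos : ∀ s ∈ uIcc r t, 0 < Z s := fun s hs => by
      rw [uIcc_of_le hrt] at hs
      exact hx.trans_le (hZmono hs.1)
    rw [← integral_comp_mul_deriv'' (g := fun x => (F x)⁻¹) hZc.continuousOn
      (fun s _ => (hZd s).hasDerivWithinAt) hzc.continuousOn
      (hgc.mono (by rintro _ ⟨s, hs, rfl⟩; exact hpos s hs))]
    have hexp : ∫ s in r..t, ((fun x => (F x)⁻¹) ∘ Z) s * z s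
        = ∫ s in r..t, Real.exp (-γ * s) := by
      refine integral_congr fun s hs => ?_
      have hF := (hFpos _ (hpos s hs)).ne'
      rw [uIcc_of_le hrt] at hs
      simp only [Function.comp, hZeq s (hr0.trans hs.1)]
      field_simp
    rw [hexp]
    calc ∫ s in r..t, Real.exp (-γ * s) ≤ ∫ _ in r..t, (1 : ℝ) := by
          refine integral_mono_on hrt (Continuous.intervalIntegrable (by fun_prop) _ _)
            intervalIntegrable_const fun s hs => Real.exp_le_one_iff.2 ?_
          nlinarith [mul_nonneg hγ (hr0.trans hs.1)]
      _ ≤ t := by simpa using hr0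
  refine hOsgood ((IntegrableOn.union (integrableOn_Ioc_zero_of_integral_le hT hgc
    (fun x hx => (inv_pos.2 (hFpos x hx)).le) hbound)
    (hgc.mono fun x hx => hT.trans_le hx.1 : ContinuousOn _ (Icc (Z t) 1)).integrableOn_Icc).mono_set ?_)
  intro x hx
  rcases le_total x (Z t) with h | h
  · exact Or.inl ⟨hx.1, h⟩
  · exact Or.inr ⟨h, hx.2⟩
end
end

section
/- Let b > 0 and α > 0. For D > 0 set β^±(D) = b/(2D) ± (1/2)√((b² + 4D)/D²) and define g(D) = (D/b) · [ (1 + β^+(D)) + (β^−(D) − 1) e^{−b/D} ] / [ β^+(D) − β^−(D) e^{−b/D} ] + D. Then g : (0,∞) → ℝ is continuous and strictly increasing, g(D) → 0 as D → 0⁺ and g(D) → +∞ as D → +∞; consequently, for every α > 0 there exists a unique D > 0 with g(D) = α. -/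
open MeasureTheory Real Set Filter

noncomputable section

/-- `β⁺(D)` for the stationary problem with constant shear rate `b`. -/
def betaPlus (b D : ℝ) : ℝ := b / (2 * D) + (1/2) * Real.sqrt ((b ^ 2 + 4 * D) / D ^ 2)

/-- `β⁻(D)` for the stationary problem with constant shear rate `b`. -/
def betaMinus (b D : ℝ) : ℝ := b / (2 * D) - (1/2) * Real.sqrt ((b ^ 2 + 4 * D) / D ^ 2)

/-- The normalization function `g(D)` whose equation `g(D) = α` expresses
`∫_ℝ p = 1` for the explicit stationary state with shear rate `b`. -/
def gNorm (b D : ℝ) : ℝ :=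
  (D / b) * (((1 + betaPlus b D) + (betaMinus b D - 1) * Real.exp (-b / D)) /
    (betaPlus b D - betaMinus b D * Real.exp (-b / D))) + D

/-- The normalization function in terms of `t = tanh (b / (2 D))` and `s = √(b² + 4 D)`. -/
theorem gNorm_eq {b D : ℝ} (hb : 0 < b) (hD : 0 < D) :
    gNorm b D = (D / b) * ((2 * D * Real.tanh (b / (2 * D)) + b
      + Real.sqrt (b ^ 2 + 4 * D) * Real.tanh (b / (2 * D))) /
      (b * Real.tanh (b / (2 * D)) + Real.sqrt (b ^ 2 + 4 * D))) + D := by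
  have hs : b < Real.sqrt (b ^ 2 + 4 * D) := by
    apply Real.lt_sqrt_of_sq_lt; linarith
  unfold gNorm betaPlus betaMinus
  rw [Real.sqrt_div' _ (sq_nonneg D), Real.sqrt_sq hD.le]
  have hE : Real.exp (-b / D) = Real.exp (-(b / (2 * D))) / Real.exp (b / (2 * D)) := by
    rw [← Real.exp_sub]; congr 1; field_simp; ring
  rw [hE, Real.tanh_eq_sinh_div_cosh, Real.sinh_eq, Real.cosh_eq]
  have hlt : Real.exp (-(b / (2 * D))) < Real.exp (b / (2 * D)) := by
    apply Real.exp_lt_exp.2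
    have : 0 < b / (2 * D) := by positivity
    linarith
  have h0 := Real.exp_pos (-(b / (2 * D)))
  generalize Real.exp (-(b / (2 * D))) = m at *
  generalize Real.exp (b / (2 * D)) = p at *
  generalize Real.sqrt (b ^ 2 + 4 * D) = s at *
  have hp : 0 < p := h0.trans hlt
  have hs0 : 0 < s := hb.trans hs
  have h1 : 0 < b * ((p - m) / 2 / ((p + m) / 2)) + s := by
    have : 0 < p - m := by linarith
    positivity
  have h2 : 0 < b / (2 * D) + 1 / 2 * (s / D) - (b / (2 * D) - 1 / 2 * (s / D)) * (m / p) := by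
    have : b / (2 * D) + 1 / 2 * (s / D) - (b / (2 * D) - 1 / 2 * (s / D)) * (m / p)
        = (b * p + s * p + (s - b) * m) / (2 * D * p) := by
      field_simp; ring
    rw [this]
    have : 0 < s - b := by linarith
    positivity
  congr 2
  rw [div_eq_div_iff h2.ne' h1.ne']
  field_simp
  ring

theorem convexOn_sinh_Ici : ConvexOn ℝ (Ici 0) Real.sinh := by
  apply convexOn_of_deriv2_nonneg (convex_Ici 0) Real.continuous_sinh.continuousOn
    Real.differentiable_sinh.differentiableOn
  · simpa using Real.differentiable_cosh.differentiableOn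
  · intro x hx
    simp only [interior_Ici, mem_Ioi] at hx
    simpa using hx.le

theorem mul_sinh_le_mul_sinh {m p : ℝ} (hm : 0 ≤ m) (hmp : m ≤ p) :
    p * Real.sinh m ≤ m * Real.sinh p := by
  rcases (hm.trans hmp).eq_or_lt with hp | hp
  · have : m = 0 := by linarith
    simp [this, ← hp]
  · have hle : 0 ≤ 1 - m / p := sub_nonneg.2 ((div_le_one hp).2 hmp)
    have h := convexOn_sinh_Ici.2 (mem_Ici.2 le_rfl) (mem_Ici.2 hp.le) hle
      (show 0 ≤ m / p by positivity) (by ring)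
    simp only [smul_eq_mul, mul_zero, Real.sinh_zero, zero_add, div_mul_cancel₀ _ hp.ne'] at h
    calc p * Real.sinh m ≤ p * (m / p * Real.sinh p) := by gcongr
      _ = m * Real.sinh p := by field_simp

theorem mul_tanh_le_mul_tanh {x y : ℝ} (hx : 0 ≤ x) (hxy : x ≤ y) :
    x * Real.tanh y ≤ y * Real.tanh x := by
  have h := mul_sinh_le_mul_sinh (m := y - x) (p := y + x) (by linarith) (by linarith)
  rw [Real.sinh_sub, Real.sinh_add] at h
  have hcx := Real.cosh_pos x
  have hcy := Real.cosh_pos y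
  rw [Real.tanh_eq_sinh_div_cosh, Real.tanh_eq_sinh_div_cosh, mul_div_assoc', mul_div_assoc',
    div_le_div_iff₀ hcy hcx]
  linarith

theorem mul_tanh_div_monotoneOn {b : ℝ} (hb : 0 < b) :
    MonotoneOn (fun D => D * Real.tanh (b / (2 * D))) (Ioi 0) := by
  intro D hD E hE hDE
  simp only [mem_Ioi] at hD hE
  have h := mul_tanh_le_mul_tanh (x := b / (2 * E)) (y := b / (2 * D)) (by positivity)
    (by gcongr)
  have h' := mul_le_mul_of_nonneg_left h (show 0 ≤ 2 * D * E / b by positivity)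
  calc D * Real.tanh (b / (2 * D)) = 2 * D * E / b * (b / (2 * E) * Real.tanh (b / (2 * D))) := by
        field_simp
    _ ≤ _ := h'
    _ = E * Real.tanh (b / (2 * E)) := by field_simp

theorem tanh_div_pos {b D : ℝ} (hb : 0 < b) (hD : 0 < D) : 0 < Real.tanh (b / (2 * D)) := by
  rw [Real.tanh_eq_sinh_div_cosh]
  exact div_pos (Real.sinh_pos_iff.2 (by positivity)) (Real.cosh_pos _)

theorem gNorm_continuousOn {b : ℝ} (hb : 0 < b) : ContinuousOn (gNorm b) (Ioi 0) := by
  refine ContinuousOn.congr ?_ fun D hD => gNorm_eq hb hD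
  have ht : ContinuousOn (fun D : ℝ => Real.tanh (b / (2 * D))) (Ioi 0) := by
    simp only [Real.tanh_eq_sinh_div_cosh]
    have hx : ContinuousOn (fun D : ℝ => b / (2 * D)) (Ioi 0) :=
      continuousOn_const.div (by fun_prop) fun D hD => by
        simp only [mem_Ioi] at hD; positivity
    exact (Real.continuous_sinh.comp_continuousOn hx).div
      (Real.continuous_cosh.comp_continuousOn hx) fun D _ => (Real.cosh_pos _).ne'
  have hs : ContinuousOn (fun D : ℝ => Real.sqrt (b ^ 2 + 4 * D)) (Ioi 0) := by fun_prop
  refine ContinuousOn.add (ContinuousOn.mul (by fun_prop) (ContinuousOn.div (by fun_prop)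
    (by fun_prop) fun D hD => ?_)) continuousOn_id
  have := tanh_div_pos hb hD
  simp only [mem_Ioi] at hD
  positivity

theorem gNorm_strictMonoOn {b : ℝ} (hb : 0 < b) : StrictMonoOn (gNorm b) (Ioi 0) := by
  intro D hD E hE hDE
  have hu := mul_tanh_div_monotoneOn hb hD hE hDE.le
  have htD := tanh_div_pos hb hD
  have htE := tanh_div_pos hb hE
  rw [gNorm_eq hb hD, gNorm_eq hb hE]
  simp only [mem_Ioi] at hD hE hu
  have hsD : 0 < Real.sqrt (b ^ 2 + 4 * D) := by positivity
  have hsD2 : Real.sqrt (b ^ 2 + 4 * D) ^ 2 = b ^ 2 + 4 * D := Real.sq_sqrt (by positivity)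
  have hsE2 : Real.sqrt (b ^ 2 + 4 * E) ^ 2 = b ^ 2 + 4 * E := Real.sq_sqrt (by positivity)
  have hsDE : Real.sqrt (b ^ 2 + 4 * D) ≤ Real.sqrt (b ^ 2 + 4 * E) := by gcongr
  generalize Real.sqrt (b ^ 2 + 4 * D) = s at *
  generalize Real.sqrt (b ^ 2 + 4 * E) = r at *
  generalize Real.tanh (b / (2 * D)) = t at *
  generalize Real.tanh (b / (2 * E)) = q at *
  have hr : 0 < r := hsD.trans_le hsDE
  have hratio : D / s ≤ E / r := by
    rw [div_le_div_iff₀ hsD hr]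
    apply (pow_le_pow_iff_left₀ (by positivity) (by positivity) two_ne_zero).1
    rw [mul_pow, mul_pow, hsD2, hsE2]
    have h1 : D ^ 2 ≤ E ^ 2 := by gcongr
    have h2 : D * E * D ≤ D * E * E := by gcongr
    nlinarith [mul_le_mul_of_nonneg_left h1 (sq_nonneg b)]
  -- with `u = D t` and `D / s` as variables, the fraction is monotone in each of them
  have hD' : D * ((2 * D * t + b + s * t) / (b * t + s))
      = (D * t * (2 * (D / s) + 1) + b * (D / s)) / (1 + b * (D * t) / (D * s)) := by
    field_simp; ring
  have hE' : E * ((2 * E * q + b + r * q) / (b * q + r))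
      = (E * q * (2 * (E / r) + 1) + b * (E / r)) / (1 + b * (E * q) / (E * r)) := by
    field_simp; ring
  have hstep₁ : (D * t * (2 * (D / s) + 1) + b * (D / s)) / (1 + b * (D * t) / (D * s))
      ≤ (E * q * (2 * (D / s) + 1) + b * (D / s)) / (1 + b * (E * q) / (D * s)) := by
    have hu0 : 0 < D * t := by positivity
    have hv0 : 0 < E * q := by positivity
    generalize D * t = u at *
    generalize E * q = v at *
    rw [div_le_div_iff₀ (by positivity) (by positivity)]
    have key : (v * (2 * (D / s) + 1) + b * (D / s)) * (1 + b * u / (D * s))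
        - (u * (2 * (D / s) + 1) + b * (D / s)) * (1 + b * v / (D * s))
        = (v - u) * (2 * (D / s) + (s ^ 2 - b ^ 2) / s ^ 2) := by
      field_simp; ring
    have : 0 ≤ (v - u) * (2 * (D / s) + (s ^ 2 - b ^ 2) / s ^ 2) := by
      rw [hsD2, add_sub_cancel_left, ← hsD2]
      have := sub_nonneg.2 hu
      positivity
    linarith
  have hstep₂ : (E * q * (2 * (D / s) + 1) + b * (D / s)) / (1 + b * (E * q) / (D * s))
      ≤ (E * q * (2 * (E / r) + 1) + b * (E / r)) / (1 + b * (E * q) / (E * r)) := by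
    gcongr
  have h := hD'.trans_le (hstep₁.trans (hstep₂.trans_eq hE'.symm))
  rw [div_mul_eq_mul_div, div_mul_eq_mul_div]
  have := div_le_div_of_nonneg_right h hb.le
  linarith

theorem le_gNorm {b D : ℝ} (hb : 0 < b) (hD : 0 < D) : D ≤ gNorm b D := by
  rw [gNorm_eq hb hD]
  have := tanh_div_pos hb hD
  have : 0 ≤ (D / b) * ((2 * D * Real.tanh (b / (2 * D)) + b
      + Real.sqrt (b ^ 2 + 4 * D) * Real.tanh (b / (2 * D))) /
      (b * Real.tanh (b / (2 * D)) + Real.sqrt (b ^ 2 + 4 * D))) := by positivity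
  linarith

theorem gNorm_le {b D : ℝ} (hb : 0 < b) (hD : 0 < D) :
    gNorm b D ≤ (D / b) * ((2 * D + b + Real.sqrt (b ^ 2 + 4 * D)) / b) + D := by
  rw [gNorm_eq hb hD]
  have h0 := tanh_div_pos hb hD
  have h1 : Real.tanh (b / (2 * D)) ≤ 1 := (Real.tanh_lt_one _).le
  have hs : b ≤ Real.sqrt (b ^ 2 + 4 * D) := Real.le_sqrt_of_sq_le (by linarith)
  have h2 := mul_le_of_le_one_right (show 0 ≤ 2 * D by positivity) h1
  have h3 := mul_le_of_le_one_right (Real.sqrt_nonneg (b ^ 2 + 4 * D)) h1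
  have h4 := mul_pos hb h0
  refine add_le_add_left (mul_le_mul_of_nonneg_left ?_ (by positivity)) D
  exact div_le_div₀ (by positivity) (by linarith) hb (by linarith)

theorem gNorm_tendsto_zero {b : ℝ} (hb : 0 < b) :
    Tendsto (gNorm b) (nhdsWithin 0 (Ioi 0)) (nhds 0) := by
  have hid : Tendsto (fun D : ℝ => D) (nhdsWithin 0 (Ioi 0)) (nhds 0) :=
    tendsto_id.mono_left nhdsWithin_le_nhds
  have hup : Tendsto (fun D : ℝ => (D / b) * ((2 * D + b + Real.sqrt (b ^ 2 + 4 * D)) / b) + D)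
      (nhdsWithin 0 (Ioi 0)) (nhds 0) := by
    have hc : Continuous
        (fun D : ℝ => (D / b) * ((2 * D + b + Real.sqrt (b ^ 2 + 4 * D)) / b) + D) := by fun_prop
    simpa using (hc.tendsto 0).mono_left nhdsWithin_le_nhds
  refine tendsto_of_tendsto_of_tendsto_of_le_of_le' hid hup ?_ ?_
  · filter_upwards [self_mem_nhdsWithin] with D hD using le_gNorm hb hD
  · filter_upwards [self_mem_nhdsWithin] with D hD using gNorm_le hb hD

theorem exists_gNorm_eq {b α : ℝ} (hb : 0 < b) (hα : 0 < α) : ∃ D, 0 < D ∧ gNorm b D = α := by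
  obtain ⟨D, hDα, hD⟩ := (((gNorm_tendsto_zero hb).eventually_lt_const hα).and
    self_mem_nhdsWithin).exists
  have hle : D ≤ α := (le_gNorm hb hD).trans hDα.le
  obtain ⟨x, hx, hxα⟩ := intermediate_value_Icc hle
    ((gNorm_continuousOn hb).mono fun y hy => lt_of_lt_of_le hD hy.1) ⟨hDα.le, le_gNorm hb hα⟩
  exact ⟨x, lt_of_lt_of_le hD hx.1, hxα⟩

/-- Proposition 5.1, case `b ≠ 0`: the normalization function
`g` is continuous and strictly increasing on `(0,∞)`, tends to `0` at `0⁺` and to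
`+∞` at `+∞`; hence `g(D) = α` has a unique positive solution for every `α > 0`. -/
theorem stationary_normalization_monotone (b : ℝ) (hb : 0 < b) :
    ContinuousOn (gNorm b) (Ioi 0) ∧
    StrictMonoOn (gNorm b) (Ioi 0) ∧
    Tendsto (gNorm b) (nhdsWithin 0 (Ioi 0)) (nhds 0) ∧
    Tendsto (gNorm b) atTop atTop ∧
    ∀ α : ℝ, 0 < α → ∃! D : ℝ, 0 < D ∧ gNorm b D = α := by
  refine ⟨gNorm_continuousOn hb, gNorm_strictMonoOn hb, gNorm_tendsto_zero hb, ?_, ?_⟩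
  · refine tendsto_atTop_mono' _ ?_ tendsto_id
    filter_upwards [eventually_gt_atTop 0] with D hD using le_gNorm hb hD
  · intro α hα
    obtain ⟨D, hD, hDα⟩ := exists_gNorm_eq hb hα
    exact ⟨D, ⟨hD, hDα⟩, fun E hE =>
      (gNorm_strictMonoOn hb).injOn hE.1 hD (hE.2.trans hDα.symm)⟩
end
end
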